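/- Approximation guarantee under large β: under the assumptions of the last-iterate bound, fix ε ∈ (0,1) and define K₀(β,ε) = min{ K ≥ 1 : Σ_{k=1}^{K−1} η_k ≥ (1/μ(β)) log(2 Err_1(β)/ε) } and B₀(β,ε,K) = min{ B ≥ 1 : Σ_{k=1}^K η_k² ≤ B ε / (L(β) σ²(β)) }. Then for all K ≥ K₀(β,ε) and B ≥ B₀(β,ε,K), E[ J_β(𝛉_K) − inf_{𝛉 ∈ 𝒜_KL} J_val(𝛉) ] ≤ ε. -/

import Mathlib

open MeasureTheory

lemma descent_aux {E : Type*} [NormedAddCommGroup E] [InnerProductSpace ℝ E] [CompleteSpace E]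
    (J : E → ℝ) (gradJ : E → E) (L : ℝ)
    (hgrad : ∀ x, HasGradientAt J (gradJ x) x)
    (hLip : ∀ x y, ‖gradJ x - gradJ y‖ ≤ L * ‖x - y‖) (x v : E) :
    J (x + v) ≤ J x + inner ℝ (gradJ x) v + L / 2 * ‖v‖ ^ 2 := by
  have hd : ∀ t : ℝ, HasDerivAt (fun t : ℝ => J (x + t • v)) (inner ℝ (gradJ (x + t • v)) v) t := by
    intro t
    have h1 : HasDerivAt (fun t : ℝ => x + t • v) v t := by
      simpa using ((hasDerivAt_id t).smul_const v).const_add x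
    have h2 := (hgrad (x + t • v)).hasFDerivAt.comp_hasDerivAt t h1
    simpa [Function.comp_def] using h2
  have hdB : ∀ t : ℝ, HasDerivAt
      (fun t : ℝ => J x + t * inner ℝ (gradJ x) v + L / 2 * ‖v‖ ^ 2 * t ^ 2)
      (inner ℝ (gradJ x) v + L * ‖v‖ ^ 2 * t) t := by
    intro t
    have h := (((hasDerivAt_id t).mul_const (inner ℝ (gradJ x) v : ℝ)).const_add (J x)).add
      (((hasDerivAt_id t).pow 2).const_mul (L / 2 * ‖v‖ ^ 2))
    refine h.congr_deriv ?_
    simp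
    ring
  have := image_le_of_deriv_right_le_deriv_boundary (a := 0) (b := 1)
    (fun t _ => (hd t).continuousAt.continuousWithinAt)
    (fun t _ => (hd t).hasDerivWithinAt) (by simp)
    (fun t _ => (hdB t).continuousAt.continuousWithinAt)
    (fun t _ => (hdB t).hasDerivWithinAt) (by
      intro t ht
      have h1 : inner ℝ (gradJ (x + t • v) - gradJ x) v ≤ L * ‖v‖ ^ 2 * t := by
        calc inner ℝ (gradJ (x + t • v) - gradJ x) v
            ≤ ‖gradJ (x + t • v) - gradJ x‖ * ‖v‖ := real_inner_le_norm _ _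
          _ ≤ (L * ‖(x + t • v) - x‖) * ‖v‖ := by gcongr; exact hLip _ _
          _ = L * ‖v‖ ^ 2 * t := by
            rw [add_sub_cancel_left, norm_smul, Real.norm_of_nonneg ht.1]; ring
      rw [inner_sub_left] at h1
      linarith) (Set.right_mem_Icc.2 zero_le_one)
  simpa using this

lemma grad_sq_le {E : Type*} [NormedAddCommGroup E] [InnerProductSpace ℝ E] [CompleteSpace E]
    (J : E → ℝ) (gradJ : E → E) (L Jstar : ℝ) (hL : 0 < L)
    (hgrad : ∀ x, HasGradientAt J (gradJ x) x)
    (hLip : ∀ x y, ‖gradJ x - gradJ y‖ ≤ L * ‖x - y‖)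
    (hmin : ∀ x, Jstar ≤ J x) (x : E) : ‖gradJ x‖ ^ 2 ≤ 2 * L * (J x - Jstar) := by
  have h := descent_aux J gradJ L hgrad hLip x (-(1 / L) • gradJ x)
  have h2 := hmin (x + -(1 / L) • gradJ x)
  rw [inner_smul_right, real_inner_self_eq_norm_sq, norm_smul, Real.norm_eq_abs, mul_pow,
    sq_abs] at h
  have e : -(1 / L) * ‖gradJ x‖ ^ 2 + L / 2 * ((-(1 / L)) ^ 2 * ‖gradJ x‖ ^ 2)
      = - (‖gradJ x‖ ^ 2 / (2 * L)) := by field_simp; ring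
  have h3 : ‖gradJ x‖ ^ 2 / (2 * L) ≤ J x - Jstar := by linarith
  rw [div_le_iff₀ (by positivity)] at h3
  linarith

lemma step_aux
    {Ω : Type*} (m : MeasurableSpace Ω) {m0 : MeasurableSpace Ω} (P : Measure Ω) [IsProbabilityMeasure P]
    {E : Type*} [NormedAddCommGroup E] [InnerProductSpace ℝ E] [CompleteSpace E]
    (J : E → ℝ) (gradJ : E → E) (Jstar L μβ s η : ℝ)
    (hL : 0 < L)
    (hgrad : ∀ x, HasGradientAt J (gradJ x) x)
    (hLip : ∀ x y, ‖gradJ x - gradJ y‖ ≤ L * ‖x - y‖)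
    (hmin : ∀ x, Jstar ≤ J x)
    (hPL : ∀ x, μβ * (J x - Jstar) ≤ (1 / 2) * ‖gradJ x‖ ^ 2)
    (hm : m ≤ m0) (θ θ' g : Ω → E)
    (hadapt : StronglyMeasurable[m] θ)
    (hupdate : ∀ ω, θ' ω = θ ω - η • g ω)
    (hintg : Integrable g P)
    (hunbiased : P[g|m] =ᵐ[P] fun ω => gradJ (θ ω))
    (hnoise_int : Integrable (fun ω => ‖g ω - gradJ (θ ω)‖ ^ 2) P)
    (hnoise : P[(fun ω => ‖g ω - gradJ (θ ω)‖ ^ 2)|m] ≤ᵐ[P] fun _ => s)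
    (hintJ : Integrable (fun ω => J (θ ω)) P)
    (hintJ' : Integrable (fun ω => J (θ' ω)) P)
    (hη0 : 0 < η) (hη : η * L ≤ 1) :
    ∫ ω, (J (θ' ω) - Jstar) ∂P
      ≤ (1 - μβ * η) * ∫ ω, (J (θ ω) - Jstar) ∂P + L / 2 * s * η ^ 2 := by
  have hcont : Continuous gradJ := by
    have : LipschitzWith L.toNNReal gradJ := LipschitzWith.of_dist_le_mul fun x y => by
      rw [dist_eq_norm, dist_eq_norm, Real.coe_toNNReal _ hL.le]; exact hLip x y
    exact this.continuous
  have hGm : StronglyMeasurable[m] (fun ω => gradJ (θ ω)) := hcont.comp_stronglyMeasurable hadapt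
  have hGm0 : StronglyMeasurable (fun ω => gradJ (θ ω)) := hGm.mono hm
  have hGint : Integrable (fun ω => gradJ (θ ω)) P := integrable_condExp.congr hunbiased
  have hErr : Integrable (fun ω => J (θ ω) - Jstar) P := hintJ.sub (integrable_const _)
  have hErr' : Integrable (fun ω => J (θ' ω) - Jstar) P := hintJ'.sub (integrable_const _)
  have hG2 : Integrable (fun ω => ‖gradJ (θ ω)‖ ^ 2) P := by
    refine (hErr.const_mul (2 * L)).mono' (hGm0.norm.pow 2).aestronglyMeasurable ?_
    refine Filter.Eventually.of_forall fun ω => ?_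
    rw [Real.norm_of_nonneg (by positivity)]
    exact grad_sq_le J gradJ L Jstar hL hgrad hLip hmin _
  have hnint : Integrable (fun ω => g ω - gradJ (θ ω)) P := hintg.sub hGint
  have hIint : Integrable (fun ω => inner ℝ (gradJ (θ ω)) (g ω - gradJ (θ ω))) P := by
    refine (hG2.add hnoise_int).mono'
      (hGm0.aestronglyMeasurable.inner hnint.aestronglyMeasurable) ?_
    refine Filter.Eventually.of_forall fun ω => ?_
    have := norm_inner_le_norm (𝕜 := ℝ) (gradJ (θ ω)) (g ω - gradJ (θ ω))
    simp only [Pi.add_apply]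
    nlinarith [sq_nonneg (‖gradJ (θ ω)‖ - ‖g ω - gradJ (θ ω)‖), sq_nonneg ‖gradJ (θ ω)‖,
      sq_nonneg ‖g ω - gradJ (θ ω)‖]
  have hc0 : P[(fun ω => g ω - gradJ (θ ω))|m] =ᵐ[P] 0 := by
    have h1 := condExp_sub hintg hGint m
    rw [condExp_of_stronglyMeasurable hm hGm hGint] at h1
    filter_upwards [h1, hunbiased] with ω h1 h2
    have h3 : P[(fun ω => g ω - gradJ (θ ω))|m] ω = P[g|m] ω - gradJ (θ ω) := h1
    rw [h3, h2]; simp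
  have hI0 : ∫ ω, inner ℝ (gradJ (θ ω)) (g ω - gradJ (θ ω)) ∂P = 0 := by
    have h := condExp_bilin_of_stronglyMeasurable_left (m := m) (μ := P) (innerSL ℝ) hGm
      (g := fun ω => g ω - gradJ (θ ω)) hIint hnint
    rw [← integral_condExp hm]
    rw [integral_eq_zero_of_ae]
    filter_upwards [h, hc0] with ω h1 h2
    refine h1.trans ?_
    rw [h2]; simp
  have hN : ∫ ω, ‖g ω - gradJ (θ ω)‖ ^ 2 ∂P ≤ s := by
    rw [← integral_condExp hm]
    calc _ ≤ ∫ _, s ∂P := integral_mono_ae integrable_condExp (integrable_const _) hnoise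
      _ = s := by simp
  have hpt : ∀ ω, J (θ' ω) - Jstar ≤ (1 - μβ * η) * (J (θ ω) - Jstar)
      + (L * η ^ 2 - η) * inner ℝ (gradJ (θ ω)) (g ω - gradJ (θ ω))
      + L / 2 * η ^ 2 * ‖g ω - gradJ (θ ω)‖ ^ 2 := by
    intro ω
    have h := descent_aux J gradJ L hgrad hLip (θ ω) (-η • g ω)
    have e1 : θ ω + -η • g ω = θ' ω := by rw [hupdate, neg_smul, sub_eq_add_neg]
    rw [e1, inner_smul_right, norm_smul, Real.norm_eq_abs, mul_pow, sq_abs] at h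
    set a := gradJ (θ ω)
    obtain ⟨n, hn⟩ : ∃ n, n = g ω - a := ⟨_, rfl⟩
    have hg : g ω = a + n := by rw [hn]; abel
    rw [← hn]
    rw [hg, inner_add_right, real_inner_self_eq_norm_sq, norm_add_sq_real] at h
    have hp := hPL (θ ω)
    have k1 : η * (μβ * (J (θ ω) - Jstar)) ≤ η * (1 / 2 * ‖a‖ ^ 2) :=
      mul_le_mul_of_nonneg_left hp hη0.le
    have k2 : 0 ≤ (1 - η * L) * (η * ‖a‖ ^ 2) :=
      mul_nonneg (by linarith) (by positivity)
    nlinarith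
  have hi1 := hErr.const_mul (1 - μβ * η)
  have hi2 := hIint.const_mul (L * η ^ 2 - η)
  have hi3 := hnoise_int.const_mul (L / 2 * η ^ 2)
  have hfin := integral_mono hErr' ((hi1.add hi2).add hi3) hpt
  have e : ∫ ω, ((1 - μβ * η) * (J (θ ω) - Jstar)
      + (L * η ^ 2 - η) * inner ℝ (gradJ (θ ω)) (g ω - gradJ (θ ω))
      + L / 2 * η ^ 2 * ‖g ω - gradJ (θ ω)‖ ^ 2) ∂P
      = (1 - μβ * η) * ∫ ω, (J (θ ω) - Jstar) ∂P
        + L / 2 * η ^ 2 * ∫ ω, ‖g ω - gradJ (θ ω)‖ ^ 2 ∂P := by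
    have a1 := integral_add (hi1.add hi2) hi3
    simp only [Pi.add_apply] at a1
    rw [a1, integral_add hi1 hi2, integral_const_mul,
      integral_const_mul, integral_const_mul, hI0]
    ring
  have hfin' := hfin.trans_eq e
  have : L / 2 * η ^ 2 * ∫ ω, ‖g ω - gradJ (θ ω)‖ ^ 2 ∂P ≤ L / 2 * η ^ 2 * s := by gcongr
  linarith


/-!
Approximation guarantee under large `β`: under the assumptions of the last-iterate bound,
fix `ε ∈ (0,1)` and define
`K₀(β,ε) = min {K ≥ 1 : Σ_{k=1}^{K-1} η_k ≥ (1/μ(β)) log (2 Err_1(β) / ε)}` and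
`B₀(β,ε,K) = min {B ≥ 1 : Σ_{k=1}^K η_k² ≤ B ε / (L(β) σ(β)²)}`.
Then for all `K ≥ K₀(β,ε)` and `B ≥ B₀(β,ε,K)` (the algorithm being run with mini-batch
size `B`), `E[J_β(θ_K) − inf_{θ ∈ 𝒜_KL} J_val θ] ≤ ε`.
-/
theorem approximation_guarantee_large_beta
    {Ω : Type*} {m0 : MeasurableSpace Ω} (P : Measure Ω) [IsProbabilityMeasure P]
    {E : Type*} [NormedAddCommGroup E] [InnerProductSpace ℝ E] [CompleteSpace E]
    (Jval JKL : E → ℝ) (J : E → ℝ) (gradJ : E → E) (Jstar : ℝ)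
    (L μβ σval σKL β : ℝ) (B : ℕ)
    (hL : 0 < L) (hμβ : 0 < μβ) (hB : 1 ≤ B) (hβ : 0 ≤ β)
    (hσval : 0 ≤ σval) (hσKL : 0 ≤ σKL)
    -- `J_β = J_val + β J_KL` with `J_KL ≥ 0`, and `𝒜_KL` nonempty
    (hJ : ∀ x, J x = Jval x + β * JKL x) (hJKL : ∀ x, 0 ≤ JKL x)
    (hAKL : {x | JKL x = 0}.Nonempty)
    -- Assumption (B)(i): smoothness
    (hgrad : ∀ x, HasGradientAt J (gradJ x) x)
    (hLip : ∀ x y, ‖gradJ x - gradJ y‖ ≤ L * ‖x - y‖)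
    -- `J_β* = inf J_β`
    (hbdd : BddBelow (Set.range J)) (hJstar : Jstar = ⨅ x, J x)
    -- Assumption (B)(ii): Polyak–Łojasiewicz condition
    (hPL : ∀ x, μβ * (J x - Jstar) ≤ (1 / 2) * ‖gradJ x‖ ^ 2)
    -- the stochastic gradient iterates with mini-batch size `B`
    (ℱ : Filtration ℕ m0) (θ g : ℕ → Ω → E) (η : ℕ → ℝ)
    (hadapt : ∀ k, StronglyMeasurable[ℱ k] (θ k))
    (hupdate : ∀ k ω, θ (k + 1) ω = θ k ω - η k • g k ω)
    (hintg : ∀ k, Integrable (g k) P)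
    (hunbiased : ∀ k, P[g k|ℱ k] =ᵐ[P] fun ω => gradJ (θ k ω))
    -- Assumption (B)(iii): conditional second-moment bound `σ(β)²/B`
    (hnoise_int : ∀ k, Integrable (fun ω => ‖g k ω - gradJ (θ k ω)‖ ^ 2) P)
    (hnoise : ∀ k, P[(fun ω => ‖g k ω - gradJ (θ k ω)‖ ^ 2)|ℱ k]
        ≤ᵐ[P] fun _ => (σval + β * σKL) ^ 2 / B)
    (hintJ : ∀ k, Integrable (fun ω => J (θ k ω)) P)
    -- nonincreasing step sizes `0 < η_K ≤ … ≤ η_1 ≤ min (1/L(β)) (1/μ(β))`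
    (hηpos : ∀ k, 1 ≤ k → 0 < η k)
    (hηmono : ∀ k, 1 ≤ k → η (k + 1) ≤ η k)
    (hη1 : η 1 ≤ min (1 / L) (1 / μβ))
    -- fix `ε ∈ (0,1)`
    (ε : ℝ) (hε0 : 0 < ε) (hε1 : ε < 1)
    -- the defining sets of `K₀(β,ε)` and `B₀(β,ε,K)` are nonempty
    (hK0ne : {K : ℕ | 1 ≤ K ∧
        (1 / μβ) * Real.log (2 * (∫ ω, (J (θ 1 ω) - Jstar) ∂P) / ε)
          ≤ ∑ k ∈ Finset.Icc 1 (K - 1), η k}.Nonempty)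
    (K : ℕ)
    -- `K ≥ K₀(β,ε)`
    (hK : sInf {K' : ℕ | 1 ≤ K' ∧
        (1 / μβ) * Real.log (2 * (∫ ω, (J (θ 1 ω) - Jstar) ∂P) / ε)
          ≤ ∑ k ∈ Finset.Icc 1 (K' - 1), η k} ≤ K)
    -- `B ≥ B₀(β,ε,K)`
    (hB0ne : {b : ℕ | 1 ≤ b ∧
        ∑ k ∈ Finset.Icc 1 K, (η k) ^ 2 ≤ b * ε / (L * (σval + β * σKL) ^ 2)}.Nonempty)
    (hBK : sInf {b : ℕ | 1 ≤ b ∧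
        ∑ k ∈ Finset.Icc 1 K, (η k) ^ 2 ≤ b * ε / (L * (σval + β * σKL) ^ 2)} ≤ B) :
    ∫ ω, (J (θ K ω) - ⨅ x : {x | JKL x = 0}, Jval x) ∂P ≤ ε := by
  have hmin : ∀ x, Jstar ≤ J x := fun x => hJstar ▸ ciInf_le hbdd x
  set s : ℝ := (σval + β * σKL) ^ 2 / B with hs
  have hs0 : 0 ≤ s := by positivity
  have hηle : ∀ k, 1 ≤ k → η k ≤ η 1 := by
    intro k hk
    induction k, hk using Nat.le_induction with
    | base => exact le_rfl
    | succ k hk ih => exact (hηmono k hk).trans ih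
  have hηL : ∀ k, 1 ≤ k → η k * L ≤ 1 := fun k hk => by
    rw [← le_div_iff₀ hL]; exact (hηle k hk).trans (hη1.trans (min_le_left _ _))
  have hημ : ∀ k, 1 ≤ k → η k * μβ ≤ 1 := fun k hk => by
    rw [← le_div_iff₀ hμβ]; exact (hηle k hk).trans (hη1.trans (min_le_right _ _))
  obtain ⟨Err, hErrdef⟩ : ∃ Err : ℕ → ℝ, Err = fun k => ∫ ω, (J (θ k ω) - Jstar) ∂P := ⟨_, rfl⟩
  have hErr0 : ∀ k, 0 ≤ Err k := fun k => by
    rw [hErrdef]; exact integral_nonneg fun ω => sub_nonneg.2 (hmin _)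
  have hstep : ∀ k, 1 ≤ k → Err (k + 1) ≤ (1 - μβ * η k) * Err k + L / 2 * s * η k ^ 2 := by
    intro k hk
    simp only [hErrdef]
    exact step_aux (ℱ k) P J gradJ Jstar L μβ s (η k) hL hgrad hLip hmin hPL (ℱ.le k) (θ k)
      (θ (k + 1)) (g k) (hadapt k) (hupdate k) (hintg k) (hunbiased k) (hnoise_int k) (hnoise k)
      (hintJ k) (hintJ (k + 1)) (hηpos k hk) (hηL k hk)
  have hrec : ∀ k : ℕ, Err (k + 1) ≤ Real.exp (-(μβ * ∑ i ∈ Finset.Icc 1 k, η i)) * Err 1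
      + L / 2 * s * ∑ i ∈ Finset.Icc 1 k, η i ^ 2 := by
    intro k
    induction k with
    | zero => simp
    | succ k ih =>
      have h := hstep (k + 1) (by omega)
      rw [Finset.sum_Icc_succ_top (by omega), Finset.sum_Icc_succ_top (by omega), mul_add, neg_add,
        Real.exp_add]
      have hη0 := hηpos (k + 1) (by omega)
      have hη1' := hημ (k + 1) (by omega)
      have hc0 : 0 ≤ 1 - μβ * η (k + 1) := by linarith
      have hc1 : 1 - μβ * η (k + 1) ≤ 1 := by
        have : 0 ≤ μβ * η (k + 1) := by positivity
        linarith
      have hce : 1 - μβ * η (k + 1) ≤ Real.exp (-(μβ * η (k + 1))) := Real.one_sub_le_exp_neg _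
      have hA : 0 ≤ Real.exp (-(μβ * ∑ i ∈ Finset.Icc 1 k, η i)) * Err 1 :=
        mul_nonneg (Real.exp_pos _).le (hErr0 1)
      have hS : 0 ≤ L / 2 * s * ∑ i ∈ Finset.Icc 1 k, η i ^ 2 := by positivity
      have i1 := mul_le_mul_of_nonneg_left ih hc0
      have i2 := mul_le_mul_of_nonneg_right hce hA
      have i3 := mul_le_mul_of_nonneg_right hc1 hS
      linarith
  -- `K` and `B` belong to the defining sets
  obtain ⟨hK0, hK0'⟩ := Nat.sInf_mem hK0ne
  set K0 := sInf {K' : ℕ | 1 ≤ K' ∧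
        (1 / μβ) * Real.log (2 * (∫ ω, (J (θ 1 ω) - Jstar) ∂P) / ε)
          ≤ ∑ k ∈ Finset.Icc 1 (K' - 1), η k} with hK0def
  have hK1 : 1 ≤ K := hK0.trans hK
  have hKsum : (1 / μβ) * Real.log (2 * Err 1 / ε) ≤ ∑ k ∈ Finset.Icc 1 (K - 1), η k := by
    rw [hErrdef]
    refine hK0'.trans (Finset.sum_le_sum_of_subset_of_nonneg
      (Finset.Icc_subset_Icc le_rfl (by omega)) fun i hi _ => (hηpos i (Finset.mem_Icc.1 hi).1).le)
  obtain ⟨hb0, hb0'⟩ := Nat.sInf_mem hB0ne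
  set b0 := sInf {b : ℕ | 1 ≤ b ∧
        ∑ k ∈ Finset.Icc 1 K, (η k) ^ 2 ≤ b * ε / (L * (σval + β * σKL) ^ 2)} with hb0def
  have hBsum : ∑ k ∈ Finset.Icc 1 K, (η k) ^ 2 ≤ B * ε / (L * (σval + β * σKL) ^ 2) := by
    refine hb0'.trans ?_
    have : (b0 : ℝ) ≤ B := by exact_mod_cast hBK
    gcongr
  have hBpos : (0 : ℝ) < B := by exact_mod_cast hB
  have hnoisepart : L / 2 * s * ∑ i ∈ Finset.Icc 1 (K - 1), η i ^ 2 ≤ ε / 2 := by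
    have h1 : ∑ i ∈ Finset.Icc 1 (K - 1), η i ^ 2 ≤ ∑ i ∈ Finset.Icc 1 K, η i ^ 2 :=
      Finset.sum_le_sum_of_subset_of_nonneg (Finset.Icc_subset_Icc le_rfl (by omega))
        fun i _ _ => sq_nonneg _
    rcases eq_or_ne (σval + β * σKL) 0 with h0 | h0
    · have : s = 0 := by rw [hs, h0]; simp
      rw [this]; simp; positivity
    · calc L / 2 * s * ∑ i ∈ Finset.Icc 1 (K - 1), η i ^ 2
          ≤ L / 2 * s * (B * ε / (L * (σval + β * σKL) ^ 2)) := by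
            gcongr; exact h1.trans hBsum
        _ = ε / 2 := by rw [hs]; field_simp
  have hexppart : Real.exp (-(μβ * ∑ i ∈ Finset.Icc 1 (K - 1), η i)) * Err 1 ≤ ε / 2 := by
    rcases (hErr0 1).eq_or_lt with h0 | h0
    · rw [← h0]; simp; positivity
    · have h1 : Real.log (2 * Err 1 / ε) ≤ μβ * ∑ i ∈ Finset.Icc 1 (K - 1), η i := by
        rw [one_div, inv_mul_le_iff₀ hμβ] at hKsum
        exact hKsum
      have hpos : 0 < 2 * Err 1 / ε := by positivity
      calc Real.exp (-(μβ * ∑ i ∈ Finset.Icc 1 (K - 1), η i)) * Err 1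
          ≤ Real.exp (-Real.log (2 * Err 1 / ε)) * Err 1 := by gcongr
        _ = ε / 2 := by
          rw [Real.exp_neg, Real.exp_log hpos]; field_simp
  have hErrK : Err K ≤ ε := by
    have := hrec (K - 1)
    rw [Nat.sub_add_cancel hK1] at this
    linarith
  have hinf : Jstar ≤ ⨅ x : {x | JKL x = 0}, Jval x := by
    have : Nonempty {x | JKL x = 0} := hAKL.to_subtype
    refine le_ciInf fun x => ?_
    have h1 : JKL x = 0 := x.2
    have h2 := hJ x
    rw [h1, mul_zero, add_zero] at h2
    rw [← h2]; exact hmin _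
  calc ∫ ω, (J (θ K ω) - ⨅ x : {x | JKL x = 0}, Jval x) ∂P
      ≤ ∫ ω, (J (θ K ω) - Jstar) ∂P :=
        integral_mono ((hintJ K).sub (integrable_const _)) ((hintJ K).sub (integrable_const _))
          fun ω => sub_le_sub_left hinf _
    _ = Err K := by rw [hErrdef]
    _ ≤ ε := hErrK
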